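/- arXiv:2403.11888 — 2 statements merged into one kernel-verified Lean document; each statement's English description precedes it below -/
import Mathlib

section
/- If there exists a graph H and a positive-valued function h on V(H) such that (H, h) is strict type 3 degenerate but H is not h-removable, then there exists a graph G and an integer k such that for the constant function g ≡ k, (G, g) is strict type 3 degenerate but G is not g-removable. -/
open scoped Classical in
/-- `Removable G S f`: all vertices of `S` (the remaining vertices of `G`) can be deleted
by legal `DelSave` operations. Deleting `u` with save-set `W ⊆ N(u)` is legal if
`f u > ∑_{w ∈ W} f w` and afterwards every remaining vertex keeps a positive value;
each deleted vertex decreases `f` by one on its unsaved neighbors. -/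
inductive Removable {V : Type*} [DecidableEq V] (G : SimpleGraph V) :
    Finset V → (V → ℕ) → Prop
  | empty (f : V → ℕ) : Removable G ∅ f
  | step (S : Finset V) (f : V → ℕ) (u : V) (W : Finset V)
      (hu : u ∈ S)
      (hW : ∀ w ∈ W, w ∈ S.erase u ∧ G.Adj u w)
      (hlegal : ∑ w ∈ W, f w < f u)
      (hpos : ∀ v ∈ S.erase u, 1 ≤ (if G.Adj u v ∧ v ∉ W then f v - 1 else f v))
      (hrec : Removable G (S.erase u) (fun v => if G.Adj u v ∧ v ∉ W then f v - 1 else f v)) :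
      Removable G S f

open scoped Classical in
/-- Strict type 3 degeneracy of a pair `(G, f)`: an edgeless graph with positive-valued `f`
is strict type 3 degenerate, and otherwise one may apply `ReduceValue` at a vertex
(decrease `f v` by one) or `EdgeDelete` at an edge `vw` (delete the edge and decrease
`f v` by `f w`). -/
inductive SD3 {V : Type*} : SimpleGraph V → (V → ℕ) → Prop
  | base (G : SimpleGraph V) (f : V → ℕ) (h : ∀ v w, ¬ G.Adj v w) (hpos : ∀ v, 1 ≤ f v) :
      SD3 G f
  | reduce (G : SimpleGraph V) (f : V → ℕ) (v : V)
      (h : SD3 G (Function.update f v (f v - 1))) : SD3 G f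
  | edgeDel (G : SimpleGraph V) (f : V → ℕ) (v w : V) (hvw : G.Adj v w)
      (h : SD3 (G.deleteEdges {s(v, w)}) (Function.update f v (f v - f w))) : SD3 G f

open scoped Classical in
/-- Removability of a set passes to the trace on an embedded union of components of that set. -/
theorem Removable.of_embedding {V V' : Type*} [DecidableEq V] [DecidableEq V']
    {H : SimpleGraph V} {G : SimpleGraph V'} (e : V ↪ V')
    (he : ∀ x y, H.Adj x y ↔ G.Adj (e x) (e y)) {S : Finset V'} {F : V' → ℕ}
    (hF : Removable G S F) :
    ∀ (S₀ : Finset V) (f : V → ℕ), (∀ x, x ∈ S₀ ↔ e x ∈ S) → (∀ x ∈ S₀, f x = F (e x)) →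
      (∀ u ∈ S, u ∉ Set.range e → ∀ x, ¬ G.Adj u (e x)) → Removable H S₀ f := by
  induction hF with
  | empty F =>
    intro S₀ f hS _ _
    obtain rfl : S₀ = ∅ := by ext x; simp [hS]
    exact .empty f
  | step S F u W hu hW hlegal hpos hrec ih =>
    intro S₀ f hS hf hsep
    by_cases hex : ∃ x, e x = u
    · obtain ⟨x, rfl⟩ := hex
      have hmem : ∀ y, y ∈ S₀.filter (fun y => e y ∈ W) ↔ e y ∈ W := by
        intro y
        simp only [Finset.mem_filter, and_iff_right_iff_imp]
        intro hy
        exact (hS y).2 (Finset.mem_of_mem_erase (hW _ hy).1)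
      have hmem_erase : ∀ y, y ∈ S₀.erase x ↔ e y ∈ S.erase (e x) := by
        intro y; simp [hS]
      have hval : ∀ y ∈ S₀.erase x,
          (if H.Adj x y ∧ y ∉ S₀.filter (fun y => e y ∈ W) then f y - 1 else f y) =
            if G.Adj (e x) (e y) ∧ e y ∉ W then F (e y) - 1 else F (e y) := by
        intro y hy
        rw [hf y (Finset.mem_of_mem_erase hy)]
        simp only [hmem, he]
      refine .step S₀ f x (S₀.filter (fun y => e y ∈ W)) ((hS x).2 hu) ?_ ?_ ?_ ?_
      · intro y hy
        have := hW _ ((hmem y).1 hy)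
        exact ⟨(hmem_erase y).2 this.1, (he x y).2 this.2⟩
      · rw [hf x ((hS x).2 hu)]
        refine lt_of_le_of_lt ?_ hlegal
        rw [Finset.sum_congr rfl (fun y hy => hf y (Finset.mem_filter.1 hy).1),
          ← Finset.sum_map _ e F]
        refine Finset.sum_le_sum_of_subset ?_
        intro z hz
        obtain ⟨y, hy, rfl⟩ := Finset.mem_map.1 hz
        exact (hmem y).1 hy
      · intro y hy
        exact (hval y hy).symm ▸ hpos _ ((hmem_erase y).1 hy)
      · exact ih _ _ hmem_erase hval fun w hw => hsep w (Finset.mem_of_mem_erase hw)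
    · have hne : ∀ x, e x ≠ u := fun x hx => hex ⟨x, hx⟩
      refine ih S₀ f (fun x => by simp [hS, hne]) (fun x hx => ?_)
        fun w hw => hsep w (Finset.mem_of_mem_erase hw)
      simpa [hsep u hu hex x] using hf x hx

/-- Copies of `H` indexed by `ι`, of which only those in `I` carry their edges, together with a
hub `none` adjacent to the vertices in `T`. -/
def hubGraph {V ι : Type*} (H : SimpleGraph V) (I : Set ι) (T : Set (ι × V)) :
    SimpleGraph (Option (ι × V)) where
  Adj
    | none, none => False
    | none, some p => p ∈ T
    | some p, none => p ∈ T
    | some p, some q => p.1 = q.1 ∧ p.1 ∈ I ∧ H.Adj p.2 q.2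
  symm := ⟨by
    rintro (_ | p) (_ | q) h
    · exact h
    · exact h
    · exact h
    · exact ⟨h.1.symm, h.1 ▸ h.2.1, h.2.2.symm⟩⟩
  loopless := ⟨by
    rintro (_ | p) h
    · exact h
    · exact H.irrefl h.2.2⟩

section hubGraph

variable {V ι : Type*} {H : SimpleGraph V} {I : Set ι} {T : Set (ι × V)}

@[simp]
theorem hubGraph_adj_none_none : ¬ (hubGraph H I T).Adj none none := id

@[simp]
theorem hubGraph_adj_none_some {p : ι × V} : (hubGraph H I T).Adj none (some p) ↔ p ∈ T := Iff.rfl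

@[simp]
theorem hubGraph_adj_some_none {p : ι × V} : (hubGraph H I T).Adj (some p) none ↔ p ∈ T := Iff.rfl

@[simp]
theorem hubGraph_adj_some_some {p q : ι × V} :
    (hubGraph H I T).Adj (some p) (some q) ↔ p.1 = q.1 ∧ p.1 ∈ I ∧ H.Adj p.2 q.2 := Iff.rfl

end hubGraph

/-- The embedding of the copy with index `i`. -/
def copyEmbedding (V : Type*) {ι : Type*} (i : ι) : V ↪ Option (ι × V) :=
  ⟨fun x => some (i, x), fun x y h => by simpa using h⟩

@[simp]
theorem copyEmbedding_apply {V ι : Type*} (i : ι) (x : V) :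
    copyEmbedding V i x = some (i, x) := rfl

open scoped Classical in
/-- If the hub has at most as many tokens as there are copies, a removal of the hub graph
restricts on some copy to a removal of `H` with one token less on `T`. -/
theorem exists_removable_copy {V ι : Type*} [DecidableEq V] [DecidableEq ι]
    {H : SimpleGraph V} {T : Set V} {S : Finset (Option (ι × V))} {F : Option (ι × V) → ℕ}
    (hF : Removable (hubGraph H Set.univ {p : ι × V | p.2 ∈ T}) S F) :
    ∀ I : Finset ι, none ∈ S → F none ≤ I.card →
      ∃ i ∈ I, (∀ x, some (i, x) ∈ S → 1 + (if x ∈ T then 1 else 0) ≤ F (some (i, x))) ∧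
        ∀ (S₀ : Finset V) (f : V → ℕ), (∀ x, x ∈ S₀ ↔ some (i, x) ∈ S) →
          (∀ x ∈ S₀, f x + (if x ∈ T then 1 else 0) = F (some (i, x))) → Removable H S₀ f := by
  induction hF with
  | empty F => intro I h; simp at h
  | step S F u W hu hW hlegal hpos hrec ih =>
    intro I hnone hcard
    have hWpos : ∀ w ∈ W, 1 ≤ F w := fun w hw => by
      simpa [hw] using hpos w (hW w hw).1
    rcases u with _ | ⟨j, u⟩
    · obtain ⟨i, hi, hiW⟩ : ∃ i ∈ I, ∀ x, some (i, x) ∉ W := by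
        by_contra! hcon
        have : Nonempty V := by
          obtain ⟨i, hi⟩ := Finset.card_pos.1 ((Nat.zero_le _).trans_lt hlegal |>.trans_le hcard)
          exact ⟨(hcon i hi).choose⟩
        choose! g hg using hcon
        have hinj : Function.Injective fun i : ι => (some (i, g i) : Option (ι × V)) :=
          fun a b hab => by simp at hab; exact hab.1
        have hsub : I.image (fun i : ι => (some (i, g i) : Option (ι × V))) ⊆ W := by
          intro z hz
          obtain ⟨i, hi, rfl⟩ := Finset.mem_image.1 hz
          exact hg i hi
        have h1 := Finset.card_le_card hsub
        rw [Finset.card_image_of_injective _ hinj] at h1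
        have h2 : W.card ≤ ∑ w ∈ W, F w := by
          rw [Finset.card_eq_sum_ones]
          exact Finset.sum_le_sum hWpos
        omega
      refine ⟨i, hi, fun x hx => ?_, fun S₀ f hS hf => ?_⟩
      · have := hpos (some (i, x)) (by simp [hx])
        by_cases hxT : x ∈ T <;> simp [hxT, hiW] at this ⊢ <;> omega
      · refine hrec.of_embedding (copyEmbedding V i) (by simp) S₀ f (by simp [hS]) ?_ ?_
        · intro x hx
          have := hf x hx
          by_cases hxT : x ∈ T <;> simp [hxT, hiW] at this ⊢ <;> omega
        · rintro (_ | ⟨l, y⟩) hy hrange x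
          · simp at hy
          · intro h
            simp only [copyEmbedding_apply, hubGraph_adj_some_some] at h
            exact hrange ⟨y, by simp [h.1]⟩
    · have hnone' : none ∈ S.erase (some (j, u)) := by simp [hnone]
      by_cases hbad : u ∈ T ∧ none ∉ W
      · obtain ⟨i, hi, hipos, hirem⟩ := ih (I.erase j) hnone' (by
          have := Finset.pred_card_le_card_erase (a := j) (s := I)
          simp [hbad]; omega)
        have hij : j ≠ i := fun h => by simp [h] at hi
        refine ⟨i, Finset.mem_of_mem_erase hi, fun x hx => ?_, fun S₀ f hS hf => ?_⟩
        · simpa [hij] using hipos x (by simp [hx, hij.symm])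
        · exact hirem S₀ f (by simp [hS, hij.symm]) (by simpa [hij] using hf)
      · obtain ⟨i, hi, hipos, hirem⟩ := ih I hnone' (by
          simp; rw [if_neg hbad]; exact hcard)
        refine ⟨i, hi, ?_⟩
        by_cases hij : j = i
        · subst hij
          have hupos : ∀ (A : Finset V), (∀ x ∈ A, some (j, x) ∈ W) →
              ∑ x ∈ A, F (some (j, x)) + (if u ∈ T then 1 else 0) < F (some (j, u)) := by
            intro A hA
            refine lt_of_le_of_lt ?_ hlegal
            have hmap : ∑ x ∈ A, F (some (j, x)) = ∑ z ∈ A.map (copyEmbedding V j), F z := by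
              simp
            have hsub : A.map (copyEmbedding V j) ⊆ W := by
              intro z hz
              obtain ⟨x, hx, rfl⟩ := Finset.mem_map.1 hz
              exact hA x hx
            rw [hmap]
            by_cases huT : u ∈ T
            · have hnW : none ∈ W := by by_contra h; exact hbad ⟨huT, h⟩
              have h1 : ∑ z ∈ insert none (A.map (copyEmbedding V j)), F z ≤ ∑ w ∈ W, F w :=
                Finset.sum_le_sum_of_subset (Finset.insert_subset hnW hsub)
              rw [Finset.sum_insert (by simp)] at h1
              have := hWpos none hnW
              simp [huT] at h1 ⊢; omega
            · simpa [huT] using Finset.sum_le_sum_of_subset (f := F) hsub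
          have hall : ∀ x, some (j, x) ∈ S →
              1 + (if x ∈ T then 1 else 0) ≤ F (some (j, x)) := by
            intro x hx
            by_cases hxu : x = u
            · subst hxu
              have := hupos ∅ (by simp)
              simp at this ⊢; omega
            · have := hipos x (by simp [hx, hxu])
              refine this.trans ?_
              dsimp only
              split_ifs <;> omega
          refine ⟨hall, fun S₀ f hS hf => ?_⟩
          have hmem : ∀ x, x ∈ S₀.filter (fun y => some (j, y) ∈ W) ↔ some (j, x) ∈ W := by
            intro x
            simp only [Finset.mem_filter, and_iff_right_iff_imp]
            intro hx
            exact (hS x).2 (Finset.mem_of_mem_erase (hW _ hx).1)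
          have hmem_erase : ∀ x, x ∈ S₀.erase u ↔ some (j, x) ∈ S.erase (some (j, u)) := by
            intro x; simp [hS]
          have hval : ∀ x ∈ S₀.erase u,
              (if H.Adj u x ∧ x ∉ S₀.filter (fun y => some (j, y) ∈ W) then f x - 1 else f x) +
                (if x ∈ T then 1 else 0) =
              if (hubGraph H Set.univ {p : ι × V | p.2 ∈ T}).Adj (some (j, u)) (some (j, x)) ∧
                some (j, x) ∉ W then F (some (j, x)) - 1 else F (some (j, x)) := by
            intro x hx
            have hx' := Finset.mem_of_mem_erase hx
            have h1 := hf x hx'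
            have h2 := hall x ((hS x).1 hx')
            simp only [hmem, hubGraph_adj_some_some, Set.mem_univ, true_and]
            split_ifs at h1 h2 ⊢ <;> omega
          have hu₀ : u ∈ S₀ := (hS u).2 hu
          refine .step S₀ f u (S₀.filter (fun y => some (j, y) ∈ W)) hu₀ ?_ ?_ ?_ ?_
          · intro x hx
            have := hW _ ((hmem x).1 hx)
            exact ⟨(hmem_erase x).2 this.1, by simpa using this.2⟩
          · have h1 := hupos (S₀.filter (fun y => some (j, y) ∈ W)) fun x hx => (hmem x).1 hx
            rw [← hf u hu₀] at h1
            refine lt_of_le_of_lt (Finset.sum_le_sum fun x hx => ?_) (Nat.lt_of_add_lt_add_right h1)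
            rw [← hf x (Finset.mem_filter.1 hx).1]
            exact Nat.le_add_right _ _
          · intro x hx
            have h1 := hval x hx
            have h2 := hipos x ((hmem_erase x).1 hx)
            dsimp only at h2
            omega
          · exact hirem _ _ hmem_erase hval
        · have hij' : i ≠ j := fun h => hij h.symm
          refine ⟨fun x hx => ?_, fun S₀ f hS hf => ?_⟩
          · simpa [hij] using hipos x (by simp [hx, hij'])
          · exact hirem S₀ f (by simp [hS, hij']) (by simpa [hij] using hf)

/-- Strict type 3 degeneracy is monotone in the values. -/
theorem SD3.mono {V : Type*} [Finite V] {G : SimpleGraph V} {f g : V → ℕ} (hf : SD3 G f)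
    (hfg : f ≤ g) : SD3 G g := by
  classical
  cases nonempty_fintype V
  induction hn : ∑ v, g v using Nat.strong_induction_on generalizing g with
  | _ n ih =>
    by_cases heq : f = g
    · exact heq ▸ hf
    · obtain ⟨v, hv⟩ : ∃ v, f v < g v := by
        by_contra! h
        exact heq (le_antisymm hfg h)
      refine .reduce G g v (ih _ ?_ ?_ rfl)
      · rw [← hn]
        refine Finset.sum_lt_sum (fun w _ => ?_) ⟨v, Finset.mem_univ v, ?_⟩
        · by_cases hw : w = v
          · subst hw; simp
          · simp [hw]
        · simp; omega
      · intro w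
        by_cases hw : w = v
        · subst hw; simp; omega
        · simpa [hw] using hfg w

open scoped Classical in
/-- The edges of an embedded copy of a strict type 3 degenerate pair can be deleted, leaving value
one on that copy. -/
theorem SD3.of_embedding {V V' : Type*} [Finite V'] (e : V ↪ V') {H : SimpleGraph V} {f : V → ℕ}
    (hf : SD3 H f) {K₀ : SimpleGraph V'} (hK₀ : ∀ x y, ¬ K₀.Adj (e x) (e y)) :
    ∀ F : V' → ℕ, (∀ x, F (e x) = f x) →
      SD3 K₀ (fun z => if z ∈ Set.range e then 1 else F z) → SD3 (K₀ ⊔ H.map e) F := by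
  induction hf with
  | base H f h hpos =>
    intro F hF hSD
    obtain rfl : H = ⊥ := by ext x y; simp [h]
    rw [show (⊥ : SimpleGraph V).map e = ⊥ by ext; simp [SimpleGraph.map_adj], sup_bot_eq]
    refine hSD.mono fun z => ?_
    dsimp only
    split_ifs with hz
    · obtain ⟨x, rfl⟩ := hz
      exact (hF x).symm ▸ hpos x
    · exact le_rfl
  | reduce H f v h ih =>
    intro F hF hSD
    refine .reduce _ _ (e v) (ih _ (fun x => ?_) ?_)
    · by_cases hx : x = v <;> simp [hx, hF]
    · convert hSD using 2 with z
      split_ifs with hz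
      · rfl
      · rw [Function.update_of_ne]
        rintro rfl
        exact hz ⟨v, rfl⟩
  | edgeDel H f v w hvw h ih =>
    intro F hF hSD
    have hgraph : (K₀ ⊔ H.map e).deleteEdges {s(e v, e w)} =
        K₀ ⊔ (H.deleteEdges {s(v, w)}).map e := by
      ext a b
      simp only [SimpleGraph.deleteEdges_adj, SimpleGraph.sup_adj, SimpleGraph.map_adj,
        Set.mem_singleton_iff]
      constructor
      · rintro ⟨hab | ⟨x, y, hxy, rfl, rfl⟩, hne⟩
        · exact .inl hab
        · refine .inr ⟨x, y, ⟨hxy, fun h => hne ?_⟩, rfl, rfl⟩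
          simpa using congrArg (Sym2.map e) h
      · rintro (hab | ⟨x, y, ⟨hxy, hne⟩, rfl, rfl⟩)
        · refine ⟨.inl hab, fun h => ?_⟩
          rcases Sym2.eq_iff.1 h with ⟨rfl, rfl⟩ | ⟨rfl, rfl⟩ <;> exact hK₀ _ _ hab
        · refine ⟨.inr ⟨x, y, hxy, rfl, rfl⟩, fun h => hne ?_⟩
          exact Sym2.map.injective e.injective (by simpa using h)
    refine .edgeDel _ _ (e v) (e w) (.inr ((SimpleGraph.map_adj_apply).2 hvw)) ?_
    rw [hgraph]
    refine ih _ (fun x => ?_) ?_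
    · by_cases hx : x = v <;> simp [hx, hF]
    · convert hSD using 2 with z
      split_ifs with hz
      · rfl
      · rw [Function.update_of_ne]
        rintro rfl
        exact hz ⟨v, rfl⟩

open scoped Classical in
/-- Disjoint copies of a strict type 3 degenerate pair with an isolated hub. -/
theorem SD3.hubGraph_empty {V ι : Type*} [Finite V] [Finite ι] {H : SimpleGraph V} {h : V → ℕ}
    (hH : SD3 H h) (I : Finset ι) :
    SD3 (hubGraph H (I : Set ι) ∅)
      (fun z => z.elim 1 fun p => if p.1 ∈ I then h p.2 else 1) := by
  induction I using Finset.induction_on with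
  | empty =>
    refine .base _ _ ?_ ?_
    · rintro (_ | p) (_ | q) <;> simp
    · rintro (_ | p) <;> simp
  | insert i I hi ih =>
    have hgraph : hubGraph H ((insert i I : Finset ι) : Set ι) ∅ =
        hubGraph H (I : Set ι) ∅ ⊔ H.map (copyEmbedding V i) := by
      ext (_ | ⟨a, x⟩) (_ | ⟨b, y⟩) <;> simp [SimpleGraph.map_adj]
      grind
    rw [hgraph]
    refine hH.of_embedding (copyEmbedding V i) (by simp [hi]) _ (by simp) ?_
    convert ih using 2 with z
    rcases z with _ | ⟨a, x⟩
    · simp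
    · by_cases ha : a = i
      · subst ha; simp [hi]
      · have : i ≠ a := fun h => ha h.symm
        simp [ha, this]

open scoped Classical in
/-- Attaching the hub to the vertices of `T` preserves strict type 3 degeneracy when each of them
receives an additional token. -/
theorem SD3.hubGraph_add {V ι : Type*} {H : SimpleGraph V} {I : Set ι} {f : ι × V → ℕ}
    (hf : SD3 (hubGraph H I ∅) (fun z => z.elim 1 f)) (T : Finset (ι × V)) :
    SD3 (hubGraph H I (T : Set (ι × V)))
      (fun z => z.elim 1 fun p => f p + if p ∈ T then 1 else 0) := by
  induction T using Finset.induction_on with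
  | empty => simpa using hf
  | insert p T hp ih =>
    refine .edgeDel _ _ (some p) none (by simp) ?_
    convert ih using 1
    · ext (_ | a) (_ | b) <;> simp <;> grind
    · funext z
      rcases z with _ | q
      · simp
      · by_cases hq : q = p
        · subst hq; simp [hp]
        · simp [hq]

/-- A counterexample with values in `[k, k + d]` yields one with a constant value. -/
theorem exists_constant_counterexample (d : ℕ) :
    ∀ (V : Type) [Fintype V] [DecidableEq V] (H : SimpleGraph V) (h : V → ℕ) (k : ℕ),
      (∀ v, k ≤ h v ∧ h v ≤ k + d) → SD3 H h → ¬ Removable H Finset.univ h →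
      ∃ (m : ℕ) (G : SimpleGraph (Fin m)) (k : ℕ),
        SD3 G (fun _ => k) ∧ ¬ Removable G Finset.univ (fun _ => k) := by
  classical
  induction d with
  | zero =>
    intro V _ _ H h k hk hSD hrem
    obtain rfl : h = fun _ => k := funext fun v => le_antisymm (hk v).2 (hk v).1
    let e := (Fintype.equivFin V).toEmbedding
    have he : ∀ z, z ∈ Set.range e := (Fintype.equivFin V).surjective
    refine ⟨Fintype.card V, H.map e, k, ?_, fun hcon => hrem ?_⟩
    · have := hSD.of_embedding e (K₀ := ⊥) (by simp) (fun _ => k) (fun _ => rfl)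
        (.base _ _ (by simp) (by simp [he]))
      simpa using this
    · exact hcon.of_embedding e (fun x y => SimpleGraph.map_adj_apply.symm) _ _ (by simp) (by simp)
        fun u _ hu => absurd (he u) hu
  | succ d ih =>
    intro V _ _ H h k hk hSD hrem
    let T : Set V := {x | h x = k}
    let g : Option (Fin (k + 1) × V) → ℕ :=
      fun z => z.elim (k + 1) fun p => h p.2 + if p.2 ∈ T then 1 else 0
    refine ih _ (hubGraph H Set.univ {p : Fin (k + 1) × V | p.2 ∈ T}) g (k + 1) ?_ ?_ ?_
    · rintro (_ | ⟨i, x⟩)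
      · simp [g]
      · have := hk x
        simp only [g, T, Option.elim_some, Set.mem_ofPred_eq]
        split_ifs <;> omega
    · have h1 := hSD.hubGraph_empty (Finset.univ : Finset (Fin (k + 1)))
      simp only [Finset.mem_univ, if_true, Finset.coe_univ] at h1
      have h2 := (h1.hubGraph_add (f := fun p => h p.2)
        (Finset.univ.filter fun p : Fin (k + 1) × V => p.2 ∈ T))
      simp only [Finset.coe_filter, Finset.mem_univ, true_and, Finset.mem_filter] at h2
      refine h2.mono ?_
      rintro (_ | p)
      · simp [g]
      · exact le_rfl
    · intro hcon
      obtain ⟨i, -, -, hi⟩ := exists_removable_copy hcon Finset.univ (by simp) (by simp [g])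
      exact hrem (hi _ _ (by simp) (by simp [g]))

/-- If some pair `(H, h)` with positive-valued `h` is strict type 3
degenerate but not removable, then there is a graph `G` and an integer `k` such that
`(G, k)` (with the constant function `k`) is strict type 3 degenerate but not removable. -/
theorem statement14
    (h : ∃ (n : ℕ) (H : SimpleGraph (Fin n)) (hfun : Fin n → ℕ),
      (∀ v, 1 ≤ hfun v) ∧ SD3 H hfun ∧ ¬ Removable H Finset.univ hfun) :
    ∃ (m : ℕ) (G : SimpleGraph (Fin m)) (k : ℕ),
      SD3 G (fun _ => k) ∧ ¬ Removable G Finset.univ (fun _ => k) := by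
  obtain ⟨n, H, f, hpos, hSD, hrem⟩ := h
  refine exists_constant_counterexample (∑ v, f v) _ H f 1 (fun v => ⟨hpos v, ?_⟩) hSD hrem
  have := Finset.single_le_sum (f := f) (fun _ _ => Nat.zero_le _) (Finset.mem_univ v)
  omega
end

section
/- For each α with 0 < α ≤ 1 there exists d₀ such that for all d ≥ d₀: every bipartite graph G with maximum degree at most d and minimum degree at least αd is f-removable for f(v) = deg(v) − ⌊(α/1000)·√(d log d)⌋. -/
open Finset in
/-- Deleting vertices in the order of increasing `r`, with prescribed save-sets `W`. -/
theorem removable_of_schedule {V : Type*} [Fintype V] [DecidableEq V] (G : SimpleGraph V)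
    [DecidableRel G.Adj] (f r : V → ℕ) (hr : Function.Injective r) (W : V → Finset V)
    (hW : ∀ u, ∀ w ∈ W u, r u < r w ∧ G.Adj u w)
    (hpos : ∀ v, #{u | r u < r v ∧ G.Adj u v ∧ v ∉ W u} < f v)
    (hlegal : ∀ u, ∑ w ∈ W u, (f w - #{x | r x < r u ∧ G.Adj x w ∧ w ∉ W x})
      < f u - #{x | r x < r u ∧ G.Adj x u ∧ u ∉ W x}) :
    Removable G univ f := by
  have key : ∀ n : ℕ, ∀ S : Finset V, #S = n → (∀ v ∉ S, ∀ w ∈ S, r v < r w) →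
      Removable G S (fun v => f v - #{x | x ∉ S ∧ G.Adj x v ∧ v ∉ W x}) := by
    intro n
    induction n with
    | zero =>
      intro S hS _
      rw [card_eq_zero.1 hS]
      exact Removable.empty _
    | succ n ih =>
      intro S hS hup
      obtain ⟨u, hu, hmin⟩ := exists_min_image S r (card_pos.1 (by omega))
      have hbefore : ∀ x, x ∉ S ↔ r x < r u := fun x =>
        ⟨fun hx => hup x hx u hu, fun hx hxS => (hmin x hxS).not_gt hx⟩
      have hup' : ∀ v ∉ S.erase u, ∀ w ∈ S.erase u, r v < r w := by
        intro v hv w hw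
        rw [mem_erase] at hw
        by_cases hvS : v ∈ S
        · obtain rfl : v = u := by
            by_contra hne
            exact hv (mem_erase.2 ⟨hne, hvS⟩)
          exact lt_of_le_of_ne (hmin w hw.2) fun h => hw.1 (hr h).symm
        · exact hup v hvS w hw.2
      have hcount : ∀ v, #{x | x ∉ S.erase u ∧ G.Adj x v ∧ v ∉ W x}
          = #{x | x ∉ S ∧ G.Adj x v ∧ v ∉ W x} + if G.Adj u v ∧ v ∉ W u then 1 else 0 := by
        intro v
        have : ({x | x ∉ S.erase u ∧ G.Adj x v ∧ v ∉ W x} : Finset V)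
            = ({x | x ∉ S ∧ G.Adj x v ∧ v ∉ W x} : Finset V)
              ∪ {x ∈ ({u} : Finset V) | G.Adj x v ∧ v ∉ W x} := by
          ext x
          by_cases hx : x = u
          · subst hx; simp [hu]
          · simp [hx]
        rw [this, card_union_of_disjoint, filter_singleton]
        · congr 1
          split_ifs <;> simp
        · refine disjoint_left.2 fun x hx hx' => ?_
          simp only [mem_filter, mem_univ, true_and, mem_singleton] at hx hx'
          exact hx.1 (hx'.1 ▸ hu)
      have hnew : ∀ v, f v - #{x | x ∉ S.erase u ∧ G.Adj x v ∧ v ∉ W x}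
          = if G.Adj u v ∧ v ∉ W u then f v - #{x | x ∉ S ∧ G.Adj x v ∧ v ∉ W x} - 1
            else f v - #{x | x ∉ S ∧ G.Adj x v ∧ v ∉ W x} := by
        intro v
        rw [hcount]
        split_ifs <;> omega
      refine Removable.step S _ u (W u) hu (fun w hw => ⟨?_, (hW u w hw).2⟩) ?_ ?_ ?_
      · have h := (hW u w hw).1
        refine mem_erase.2 ⟨fun h' => by simp [h'] at h, ?_⟩
        by_contra hc
        exact absurd ((hbefore w).1 hc) (by omega)
      · simp only [hbefore]
        exact hlegal u
      · intro v hv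
        have h1 : #{x | x ∉ S.erase u ∧ G.Adj x v ∧ v ∉ W x}
            ≤ #{x | r x < r v ∧ G.Adj x v ∧ v ∉ W x} := by
          refine card_le_card fun x hx => ?_
          simp only [mem_filter, mem_univ, true_and] at hx ⊢
          exact ⟨hup' x hx.1 v hv, hx.2⟩
        have h2 := hpos v
        have h3 := hnew v
        have h4 : 1 ≤ f v - #{x | x ∉ S.erase u ∧ G.Adj x v ∧ v ∉ W x} := by omega
        rw [h3] at h4
        convert h4
      · have := ih (S.erase u) (by rw [card_erase_of_mem hu]; omega) hup'
        simp only [hnew] at this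
        convert this
  have := key _ univ rfl (by simp)
  simpa using this

open Finset in
/-- Events depending on disjoint sets of coordinates are independent. -/
theorem card_inter_mul_card_univ_of_depends {V C : Type*} [Fintype V] [DecidableEq V]
    [Fintype C] [DecidableEq C] (E F : Finset (V → C)) (s : Finset V)
    (hE : ∀ x y : V → C, (∀ v ∈ s, x v = y v) → x ∈ E → y ∈ E)
    (hF : ∀ x y : V → C, (∀ v ∉ s, x v = y v) → x ∈ F → y ∈ F) :
    #(E ∩ F) * Fintype.card (V → C) = #E * #F := by
  rw [← Finset.card_univ, ← card_product, ← card_product]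
  refine card_nbij' (fun q => (s.piecewise q.1 q.2, s.piecewise q.2 q.1))
    (fun q => (s.piecewise q.1 q.2, s.piecewise q.2 q.1)) ?_ ?_ ?_ ?_
  · rintro ⟨x, y⟩ h
    simp only [coe_product, Set.mem_prod, mem_coe, mem_inter, mem_univ, and_true] at h ⊢
    exact ⟨hE x _ (fun v hv => by simp [hv]) h.1, hF x _ (fun v hv => by simp [hv]) h.2⟩
  · rintro ⟨x, y⟩ h
    simp only [coe_product, Set.mem_prod, mem_coe, mem_inter, mem_univ, and_true] at h ⊢
    exact ⟨hE x _ (fun v hv => by simp [hv]) h.1, hF y _ (fun v hv => by simp [hv]) h.2⟩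
  all_goals
    rintro ⟨x, y⟩ -
    ext v <;> by_cases hv : v ∈ s <;> simp [hv]

open Finset in
/-- The symmetric Lovász local lemma for the uniform measure on a finite product space. -/
theorem exists_forall_notMem_of_local {ι V C : Type*} [Fintype ι] [DecidableEq ι]
    [Fintype V] [DecidableEq V] [Fintype C] [DecidableEq C] [Nonempty C]
    (E : ι → Finset (V → C)) (s : ι → Finset V)
    (hE : ∀ i, ∀ x y : V → C, (∀ v ∈ s i, x v = y v) → x ∈ E i → y ∈ E i)
    (p D : ℝ) (hp : 0 ≤ p) (hD : 1 ≤ D) (hpD : 4 * p * D ≤ 1)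
    (hprob : ∀ i, (#(E i) : ℝ) ≤ p * Fintype.card (V → C))
    (hdeg : ∀ i, (#{j | ¬ Disjoint (s i) (s j)} : ℝ) ≤ D) :
    ∃ x : V → C, ∀ i, x ∉ E i := by
  have hN : (0 : ℝ) < Fintype.card (V → C) := by exact_mod_cast Fintype.card_pos
  have hp2 : 2 * p ≤ 1 / 2 := by nlinarith
  let F : Finset ι → Finset (V → C) := fun S => {x | ∀ i ∈ S, x ∉ E i}
  have hFmono : ∀ {S S' : Finset ι}, S ⊆ S' → F S' ⊆ F S := by
    intro S S' h x hx
    simp only [F, mem_filter, mem_univ, true_and] at hx ⊢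
    exact fun i hi => hx i (h hi)
  have key : ∀ n : ℕ, ∀ S : Finset ι, #S = n → ∀ i,
      i ∉ S → (#(E i ∩ F S) : ℝ) ≤ 2 * p * #(F S) := by
    intro n
    induction n using Nat.strong_induction_on with
    | _ n ih =>
    intro S hS i hi
    set S₂ : Finset ι := {j ∈ S | Disjoint (s i) (s j)} with hS₂
    set S₁ : Finset ι := {j ∈ S | ¬ Disjoint (s i) (s j)} with hS₁
    have hind : (#(E i ∩ F S₂) : ℝ) ≤ p * #(F S₂) := by
      have := card_inter_mul_card_univ_of_depends (E i) (F S₂) (s i) (hE i) (by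
        intro x y hxy hx
        simp only [F, mem_filter, mem_univ, true_and] at hx ⊢
        intro j hj hyj
        refine hx j hj (hE j y x (fun v hv => (hxy v ?_).symm) hyj)
        exact fun hv' => Finset.disjoint_left.1 (mem_filter.1 hj).2 hv' hv)
      have h' : (#(E i ∩ F S₂) : ℝ) * Fintype.card (V → C) = #(E i) * #(F S₂) := by
        exact_mod_cast this
      have h2 : (#(E i) : ℝ) * #(F S₂) ≤ p * Fintype.card (V → C) * #(F S₂) := by
        gcongr; exact hprob i
      nlinarith
    have hle : (#(E i ∩ F S) : ℝ) ≤ #(E i ∩ F S₂) := by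
      exact_mod_cast card_le_card (inter_subset_inter_left (hFmono (filter_subset _ _)))
    have hhalf : (#(F S₂) : ℝ) ≤ 2 * #(F S) := by
      by_cases hemp : S₁ = ∅
      · have : S₂ = S := by
          rw [hS₂, filter_eq_self]
          intro j hj
          by_contra hc
          exact notMem_empty j (hemp ▸ mem_filter.2 ⟨hj, hc⟩)
        rw [this]
        linarith [(Nat.cast_nonneg #(F S) : (0 : ℝ) ≤ _)]
      · have hlt : #S₂ < n := by
          have h1 := card_filter_add_card_filter_not (s := S) (fun j => Disjoint (s i) (s j))
          have h2 : 0 < #S₁ := card_pos.2 (nonempty_iff_ne_empty.2 hemp)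
          rw [← hS₂, ← hS₁] at h1
          omega
        have hcover : F S₂ ⊆ F S ∪ S₁.biUnion (fun j => E j ∩ F S₂) := by
          intro x hx
          by_cases hxS : x ∈ F S
          · exact mem_union_left _ hxS
          · refine mem_union_right _ ?_
            simp only [F, mem_filter, mem_univ, true_and, not_forall, not_not] at hxS
            obtain ⟨j, hj, hxj⟩ := hxS
            refine mem_biUnion.2 ⟨j, mem_filter.2 ⟨hj, fun hdis => ?_⟩, mem_inter.2 ⟨hxj, hx⟩⟩
            exact (mem_filter.1 hx).2 j (mem_filter.2 ⟨hj, hdis⟩) hxj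
        have hc1 : (#(F S₂) : ℝ) ≤ #(F S) + ∑ j ∈ S₁, (#(E j ∩ F S₂) : ℝ) := by
          exact_mod_cast (card_le_card hcover).trans
            ((card_union_le _ _).trans (Nat.add_le_add_left card_biUnion_le _))
        have hc2 : ∑ j ∈ S₁, (#(E j ∩ F S₂) : ℝ) ≤ #S₁ * (2 * p * #(F S₂)) := by
          rw [← nsmul_eq_mul]
          refine sum_le_card_nsmul _ _ _ (fun j hj => ih _ hlt S₂ rfl j ?_)
          exact fun hj' => (mem_filter.1 hj).2 (mem_filter.1 hj').2
        have hc3 : (#S₁ : ℝ) ≤ D := by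
          refine le_trans ?_ (hdeg i)
          exact_mod_cast card_le_card (filter_subset_filter _ (subset_univ S))
        have h0 : (0 : ℝ) ≤ #(F S₂) := Nat.cast_nonneg _
        have hc4 : (#S₁ : ℝ) * (2 * p * #(F S₂)) ≤ D * (2 * p * #(F S₂)) := by gcongr
        nlinarith
    nlinarith
  have hpos : ∀ S : Finset ι, (0 : ℝ) < #(F S) := by
    intro S
    induction S using Finset.induction_on with
    | empty => simpa [F] using hN
    | insert i S hi ih =>
      have hcover : F S ⊆ F (insert i S) ∪ (E i ∩ F S) := by
        intro x hx
        by_cases hxi : x ∈ E i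
        · exact mem_union_right _ (mem_inter.2 ⟨hxi, hx⟩)
        · refine mem_union_left _ ?_
          simp only [F, mem_filter, mem_univ, true_and, mem_insert] at hx ⊢
          rintro j (rfl | hj)
          exacts [hxi, hx j hj]
      have h1 : (#(F S) : ℝ) ≤ #(F (insert i S)) + #(E i ∩ F S) := by
        exact_mod_cast (card_le_card hcover).trans (card_union_le _ _)
      have h2 := key _ S rfl i hi
      nlinarith
  obtain ⟨x, hx⟩ := card_pos.1 (by exact_mod_cast hpos univ : 0 < #(F univ))
  exact ⟨x, fun i => (mem_filter.1 hx).2 i (mem_univ i)⟩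


open Finset in
/-- Moment generating function bound for the number of elements of `N` with label `c`. -/
theorem sum_pow_card_filter_le {V : Type*} [Fintype V] [DecidableEq V] (T : ℕ)
    (hT : 0 < T) (c : Fin T) (N : Finset V) (r : ℝ) (hr : 0 ≤ r) :
    ∑ x : V → Fin T, r ^ #{w ∈ N | x w = c}
      ≤ Real.exp ((r - 1) * #N / T) * Fintype.card (V → Fin T) := by
  have hT' : (0 : ℝ) < T := by exact_mod_cast hT
  have h1 : ∀ x : V → Fin T, r ^ #{w ∈ N | x w = c}
      = ∏ w, (if w ∈ N ∧ x w = c then r else 1) := by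
    intro x
    rw [← prod_filter, prod_const]
    congr 2
    ext; simp
  have h2 : ∀ w : V, ∑ i : Fin T, (if w ∈ N ∧ i = c then r else (1 : ℝ))
      = T * (if w ∈ N then 1 + (r - 1) / T else 1) := by
    intro w
    by_cases hw : w ∈ N
    · have : ∀ i : Fin T, (if i = c then r else (1 : ℝ)) = (if i = c then r - 1 else 0) + 1 := by
        intro i; split_ifs <;> ring
      simp only [hw, true_and, if_true, this, sum_add_distrib, sum_ite_eq', mem_univ]
      simp
      field_simp
      ring
    · simp [hw]
  simp only [h1]
  rw [← Fintype.piFinset_univ, ← prod_univ_sum (fun _ => univ)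
    (fun w i => if w ∈ N ∧ i = c then r else (1 : ℝ))]
  simp only [h2]
  rw [prod_mul_distrib, prod_const, Fintype.card_fun, Fintype.card_fin, Finset.card_univ, mul_comm,
    ← prod_filter, prod_const, Nat.cast_pow]
  gcongr
  have h3 : (0 : ℝ) ≤ 1 + (r - 1) / T := by
    have : (1 : ℝ) ≤ T := by exact_mod_cast hT
    have : 1 + (r - 1) / T = (T - 1 + r) / T := by field_simp; ring
    rw [this]; exact div_nonneg (by linarith) hT'.le
  calc _ ≤ Real.exp ((r - 1) / T) ^ #N := by
        rw [show #{a | a ∈ N} = #N by congr 1; ext; simp]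
        gcongr
        linarith [Real.add_one_le_exp ((r - 1) / T)]
    _ = _ := by rw [← Real.exp_nat_mul]; congr 1; ring

open Finset in
/-- Chernoff bound: few labellings are unbalanced on `N`. -/
theorem card_unbalanced_le {V : Type*} [Fintype V] [DecidableEq V] (T : ℕ) (hT : 0 < T)
    (N : Finset V) :
    (#{x : V → Fin T | ∃ c, ¬ ((#N : ℝ) / (2 * T) ≤ #{w ∈ N | x w = c} ∧
        (#{w ∈ N | x w = c} : ℝ) ≤ 2 * #N / T)} : ℝ)
      ≤ 2 * T * Real.exp (-(#N / (10 * T))) * Fintype.card (V → Fin T) := by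
  have hT' : (0 : ℝ) < T := by exact_mod_cast hT
  set q : ℝ := #N / T with hq
  have hq0 : 0 ≤ q := by positivity
  have he := Real.exp_one_lt_d9
  have he' := Real.exp_one_gt_d9
  have hlow : Real.exp (-1) ≤ 0.37 := by
    rw [Real.exp_neg, inv_le_comm₀ (Real.exp_pos _) (by norm_num)]
    refine le_trans ?_ he'.le
    norm_num
  have hpt : ∀ x : V → Fin T, (if ∃ c, ¬ ((#N : ℝ) / (2 * T) ≤ #{w ∈ N | x w = c} ∧
        (#{w ∈ N | x w = c} : ℝ) ≤ 2 * #N / T) then (1 : ℝ) else 0)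
      ≤ ∑ c : Fin T, (Real.exp (q / 2) * Real.exp (-1) ^ #{w ∈ N | x w = c}
        + Real.exp (-(2 * q)) * Real.exp 1 ^ #{w ∈ N | x w = c}) := by
    intro x
    split_ifs with h
    · obtain ⟨c, hc⟩ := h
      refine le_trans ?_ (single_le_sum (f := fun c =>
        Real.exp (q / 2) * Real.exp (-1) ^ #{w ∈ N | x w = c}
        + Real.exp (-(2 * q)) * Real.exp 1 ^ #{w ∈ N | x w = c})
        (fun c _ => by positivity) (mem_univ c))
      rw [← Real.exp_nat_mul, ← Real.exp_nat_mul, ← Real.exp_add, ← Real.exp_add]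
      rw [show (#N : ℝ) / (2 * T) = q / 2 by rw [hq]; field_simp,
        show 2 * (#N : ℝ) / T = 2 * q by rw [hq]; ring, not_and_or, not_le, not_le] at hc
      rcases hc with hc | hc
      · have := Real.one_le_exp (x := q / 2 + #{w ∈ N | x w = c} * -1) (by linarith)
        linarith [Real.exp_pos (-(2 * q) + #{w ∈ N | x w = c} * 1)]
      · have := Real.one_le_exp (x := -(2 * q) + #{w ∈ N | x w = c} * 1) (by linarith)
        linarith [Real.exp_pos (q / 2 + #{w ∈ N | x w = c} * -1)]
    · positivity
  rw [← sum_boole]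
  refine (sum_le_sum fun x _ => hpt x).trans ?_
  rw [sum_comm]
  have hc : ∀ c : Fin T, ∑ x : V → Fin T,
      (Real.exp (q / 2) * Real.exp (-1) ^ #{w ∈ N | x w = c}
        + Real.exp (-(2 * q)) * Real.exp 1 ^ #{w ∈ N | x w = c})
      ≤ 2 * Real.exp (-(q / 10)) * Fintype.card (V → Fin T) := by
    intro c
    rw [sum_add_distrib, ← mul_sum, ← mul_sum]
    have b1 := sum_pow_card_filter_le T hT c N (Real.exp (-1)) (Real.exp_pos _).le
    have b2 := sum_pow_card_filter_le T hT c N (Real.exp 1) (Real.exp_pos _).le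
    rw [mul_div_assoc, ← hq] at b1 b2
    have e1 : Real.exp (q / 2) * Real.exp ((Real.exp (-1) - 1) * q) ≤ Real.exp (-(q / 10)) := by
      rw [← Real.exp_add]; gcongr; nlinarith
    have e2 : Real.exp (-(2 * q)) * Real.exp ((Real.exp 1 - 1) * q) ≤ Real.exp (-(q / 10)) := by
      rw [← Real.exp_add]; gcongr; nlinarith
    calc _ ≤ Real.exp (q / 2) * (Real.exp ((Real.exp (-1) - 1) * q) * Fintype.card (V → Fin T))
          + Real.exp (-(2 * q)) * (Real.exp ((Real.exp 1 - 1) * q) * Fintype.card (V → Fin T)) := by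
          gcongr
      _ = (Real.exp (q / 2) * Real.exp ((Real.exp (-1) - 1) * q)
          + Real.exp (-(2 * q)) * Real.exp ((Real.exp 1 - 1) * q)) * Fintype.card (V → Fin T) := by
          ring
      _ ≤ (Real.exp (-(q / 10)) + Real.exp (-(q / 10))) * Fintype.card (V → Fin T) := by
          gcongr
      _ = _ := by ring
  refine (sum_le_sum fun c _ => hc c).trans (le_of_eq ?_)
  rw [sum_const, card_univ, Fintype.card_fin, nsmul_eq_mul,
    show (#N : ℝ) / (10 * T) = q / 10 by rw [hq]; field_simp]
  ring

open Finset in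
/-- There is a labelling in which every vertex sees each label about equally often. -/
theorem exists_balanced_labelling {V : Type*} [Fintype V] [DecidableEq V] (G : SimpleGraph V)
    [DecidableRel G.Adj] (d T : ℕ) (α : ℝ) (hd : 0 < d) (hT : 0 < T)
    (hmax : ∀ v, G.degree v ≤ d) (hmin : ∀ v, α * d ≤ (G.degree v : ℝ))
    (hprob : 8 * (d : ℝ) ^ 2 * T * Real.exp (-(α * d / (10 * T))) ≤ 1) :
    ∃ x : V → Fin T, ∀ v c,
      (G.degree v : ℝ) / (2 * T) ≤ #{w ∈ G.neighborFinset v | x w = c} ∧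
      (#{w ∈ G.neighborFinset v | x w = c} : ℝ) ≤ 2 * G.degree v / T := by
  have hT' : (0 : ℝ) < T := by exact_mod_cast hT
  have hd' : (1 : ℝ) ≤ d := by exact_mod_cast hd
  have : Nonempty (Fin T) := ⟨⟨0, hT⟩⟩
  obtain ⟨x, hx⟩ := exists_forall_notMem_of_local
    (fun v => {x : V → Fin T | ∃ c, ¬ ((#(G.neighborFinset v) : ℝ) / (2 * T)
        ≤ #{w ∈ G.neighborFinset v | x w = c} ∧
        (#{w ∈ G.neighborFinset v | x w = c} : ℝ) ≤ 2 * #(G.neighborFinset v) / T)})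
    (fun v => G.neighborFinset v)
    (by
      intro v x y hxy hx
      have : ∀ c, ({w ∈ G.neighborFinset v | x w = c} : Finset V)
          = {w ∈ G.neighborFinset v | y w = c} :=
        fun c => filter_congr fun w hw => by rw [hxy w hw]
      simp only [mem_filter, this] at hx ⊢
      exact ⟨mem_univ _, hx.2⟩)
    (2 * T * Real.exp (-(α * d / (10 * T)))) ((d : ℝ) ^ 2) (by positivity) (by nlinarith)
    (by linarith)
    (by
      intro v
      refine (card_unbalanced_le T hT (G.neighborFinset v)).trans ?_
      gcongr
      rw [G.card_neighborFinset_eq_degree]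
      exact hmin v)
    (by
      intro v
      have hsub : ({w | ¬ Disjoint (G.neighborFinset v) (G.neighborFinset w)} : Finset V)
          ⊆ (G.neighborFinset v).biUnion fun u => G.neighborFinset u := by
        intro w hw
        obtain ⟨u, hu, hu'⟩ := not_disjoint_iff.1 (mem_filter.1 hw).2
        refine mem_biUnion.2 ⟨u, hu, ?_⟩
        rw [SimpleGraph.mem_neighborFinset] at hu' ⊢
        exact hu'.symm
      have h := (card_le_card hsub).trans (card_biUnion_le_card_mul _ _ d fun u _ => by
        rw [G.card_neighborFinset_eq_degree]; exact hmax u)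
      rw [G.card_neighborFinset_eq_degree] at h
      have h2 := h.trans (Nat.mul_le_mul_right d (hmax v))
      rw [sq]
      exact_mod_cast h2)
  refine ⟨x, fun v c => ?_⟩
  by_contra hc
  refine hx v (mem_filter.2 ⟨mem_univ _, c, ?_⟩)
  rwa [G.card_neighborFinset_eq_degree]

open Finset in
/-- A weighted, capacitated form of the marriage theorem of Hall. -/
theorem exists_assignment_of_weights {ι V : Type*} [Fintype ι] [DecidableEq ι] [DecidableEq V]
    (t : ι → Finset V) (ω : V → ℝ) (m : V → ℕ)
    (ht : ∀ x, 1 ≤ ∑ a ∈ t x, ω a)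
    (hm : ∀ a, ∀ s : Finset ι, ω a * #{x ∈ s | a ∈ t x} ≤ m a) :
    ∃ φ : ι → V, (∀ x, φ x ∈ t x) ∧ ∀ a, #{x | φ x = a} ≤ m a := by
  classical
  have hall := (all_card_le_biUnion_card_iff_exists_injective
    (fun x => (t x).sigma (fun a => (univ : Finset (Fin (m a)))))).1 (by
      intro s
      have hbi : s.biUnion (fun x => (t x).sigma (fun a => (univ : Finset (Fin (m a)))))
          = (s.biUnion t).sigma (fun a => univ) := by
        ext ⟨a, j⟩; simp
      rw [hbi, card_sigma]
      simp only [card_univ, Fintype.card_fin]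
      have : (#s : ℝ) ≤ ∑ a ∈ s.biUnion t, (m a : ℝ) := by
        calc (#s : ℝ) = ∑ x ∈ s, (1 : ℝ) := by simp
          _ ≤ ∑ x ∈ s, ∑ a ∈ t x, ω a := sum_le_sum fun x _ => ht x
          _ = ∑ a ∈ s.biUnion t, ∑ x ∈ s with a ∈ t x, ω a := by
              refine sum_comm' fun x a => ?_
              simp only [mem_biUnion, mem_filter]
              exact ⟨fun h => ⟨h, x, h⟩, fun h => h.1⟩
          _ ≤ ∑ a ∈ s.biUnion t, (m a : ℝ) := by
              refine sum_le_sum fun a _ => ?_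
              rw [sum_const, nsmul_eq_mul, mul_comm]
              exact hm a s
      exact_mod_cast this)
  obtain ⟨F, hF, hFt⟩ := hall
  refine ⟨fun x => (F x).1, fun x => (mem_sigma.1 (hFt x)).1, fun a => ?_⟩
  have : #(image F {x | (F x).1 = a})
      ≤ #(({a} : Finset V).sigma fun a => (univ : Finset (Fin (m a)))) := by
    refine card_le_card fun y hy => ?_
    obtain ⟨x, hx, rfl⟩ := mem_image.1 hy
    simpa using hx
  rw [card_image_of_injective _ hF] at this
  simpa using this

open Finset in
theorem exists_subset_sum_mem_Icc {V : Type*} [DecidableEq V] (N : Finset V) (ω : V → ℝ)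
    (h1 : ∀ a ∈ N, ω a ≤ 1) (hN : 1 ≤ ∑ a ∈ N, ω a) :
    ∃ s ⊆ N, 1 ≤ ∑ a ∈ s, ω a ∧ ∑ a ∈ s, ω a ≤ 2 := by
  induction N using Finset.induction_on with
  | empty => simp at hN; linarith
  | insert b N hb ih =>
    by_cases h : 1 ≤ ∑ a ∈ N, ω a
    · obtain ⟨s, hs, hs'⟩ := ih (fun a ha => h1 a (mem_insert_of_mem ha)) h
      exact ⟨s, hs.trans (subset_insert _ _), hs'⟩
    · refine ⟨insert b N, subset_rfl, hN, ?_⟩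
      rw [sum_insert hb]
      linarith [h1 b (mem_insert_self _ _)]

open Finset in
/-- A set of total weight at least `2 * n` splits into `n` groups of weight at least `1`. -/
theorem exists_grouping_of_weights {V : Type*} [DecidableEq V] (ω : V → ℝ) (h0 : ∀ a, 0 ≤ ω a)
    (h1 : ∀ a, ω a ≤ 1) (n : ℕ) (N : Finset V) (hN : 2 * n ≤ ∑ a ∈ N, ω a) :
    ∃ g : V → ℕ, ∀ j < n, 1 ≤ ∑ a ∈ N with g a = j, ω a := by
  induction n generalizing N with
  | zero => exact ⟨fun _ => 0, by simp⟩
  | succ n ih =>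
    push_cast at hN
    obtain ⟨s, hs, hs1, hs2⟩ := exists_subset_sum_mem_Icc N ω (fun a _ => h1 a)
      (by linarith [(Nat.cast_nonneg n : (0 : ℝ) ≤ n)])
    obtain ⟨g, hg⟩ := ih (N \ s) (by
      have := sum_sdiff (f := ω) hs
      linarith)
    refine ⟨fun a => if a ∈ s then n else g a, fun j hj => ?_⟩
    obtain rfl | hlt := Nat.lt_succ_iff_lt_or_eq.1 hj |>.symm
    · refine hs1.trans (sum_le_sum_of_subset_of_nonneg ?_ fun a _ _ => h0 a)
      intro a ha
      simp [ha, hs ha]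
    · refine (hg j hlt).trans (sum_le_sum_of_subset_of_nonneg ?_ fun a _ _ => h0 a)
      intro a ha
      simp only [mem_filter, mem_sdiff] at ha ⊢
      simp [ha]

open Finset in
/-- Every vertex of `B` can be saved exactly `n` times by its neighbours in `A`, where `a`
saves at most `m a` vertices. -/
theorem exists_saving_sets {V : Type*} [Fintype V] [DecidableEq V] (G : SimpleGraph V)
    [DecidableRel G.Adj] (A B : Finset V) (ω : V → ℝ) (h0 : ∀ a, 0 ≤ ω a) (h1 : ∀ a, ω a ≤ 1)
    (m : V → ℕ) (n : ℕ) (hB : ∀ b ∈ B, 2 * n ≤ ∑ a ∈ A with G.Adj a b, ω a)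
    (hA : ∀ a ∈ A, ω a * #{b ∈ B | G.Adj a b} ≤ m a) :
    ∃ W : V → Finset V, (∀ a, ∀ b ∈ W a, a ∈ A ∧ b ∈ B ∧ G.Adj a b) ∧ (∀ a, #(W a) ≤ m a) ∧
      ∀ b ∈ B, #{a | b ∈ W a} = n := by
  have hg : ∀ b : B, ∃ g : V → ℕ, ∀ j < n, 1 ≤ ∑ a ∈ {a ∈ A | G.Adj a b} with g a = j, ω a :=
    fun b => exists_grouping_of_weights ω h0 h1 n _ (hB b b.2)
  choose g hg using hg
  let t : B × Fin n → Finset V := fun x => {a ∈ {a ∈ A | G.Adj a x.1} | g x.1 a = x.2}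
  have hcount : ∀ a, ∀ s : Finset (B × Fin n), #{x ∈ s | a ∈ t x} ≤ #{b ∈ B | G.Adj a b} := by
    intro a s
    refine card_le_card_of_injOn (fun x => (x.1 : V)) ?_ ?_
    · rintro ⟨b, j⟩ hx
      simp only [coe_filter, Set.mem_ofPred_eq, t, mem_filter] at hx ⊢
      exact ⟨b.2, hx.2.1.2⟩
    · rintro ⟨b, j⟩ hx ⟨b', j'⟩ hx' h
      simp only [coe_filter, Set.mem_ofPred_eq, t, mem_filter] at hx hx'
      obtain rfl : b = b' := Subtype.ext h
      have : j = j' := Fin.ext (hx.2.2.symm.trans hx'.2.2)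
      rw [this]
  obtain ⟨φ, hφ, hφm⟩ := exists_assignment_of_weights t ω m (fun x => hg x.1 x.2 x.2.2) (by
    intro a s
    by_cases ha : a ∈ A
    · refine le_trans ?_ (hA a ha)
      have := h0 a
      gcongr
      exact hcount a s
    · have : ({x ∈ s | a ∈ t x} : Finset _) = ∅ := by
        refine filter_eq_empty_iff.2 fun x _ hx => ha ?_
        simp only [t, mem_filter] at hx
        exact hx.1.1
      simp [this])
  refine ⟨fun a => image (fun x => (x.1 : V)) {x | φ x = a}, ?_, ?_, ?_⟩
  · intro a b hb
    obtain ⟨x, hx, rfl⟩ := mem_image.1 hb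
    have h := hφ x
    rw [(mem_filter.1 hx).2] at h
    simp only [t, mem_filter] at h
    exact ⟨h.1.1, x.1.2, h.1.2⟩
  · exact fun a => card_image_le.trans (hφm a)
  · intro b hb
    have : ({a | b ∈ image (fun x => (x.1 : V)) {x | φ x = a}} : Finset V)
        = image (fun j => φ (⟨b, hb⟩, j)) univ := by
      ext a
      simp only [mem_filter, mem_univ, true_and, mem_image]
      constructor
      · rintro ⟨⟨b', j⟩, h, rfl⟩
        exact ⟨j, h⟩
      · rintro ⟨j, h⟩
        exact ⟨_, h, rfl⟩
    rw [this, card_image_of_injective, card_univ, Fintype.card_fin]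
    intro j j' h
    have e := hφ (⟨b, hb⟩, j)
    have e' := hφ (⟨b, hb⟩, j')
    simp only [t, mem_filter] at e e' h
    rw [h] at e
    exact Fin.ext (e.2.symm.trans e'.2)

open Finset in
theorem log_sub_one_le_sum_reciprocal (T : ℕ) (y : ℝ) (hy : 0 < y) (hyT : y ≤ T) :
    Real.log y - 1 ≤ ∑ i : Fin T,
      if (i : ℕ) + 1 < T ∧ (T : ℝ) - (i : ℕ) ≤ y then 1 / ((T : ℝ) - (i : ℕ)) else 0 := by
  rw [Fin.sum_univ_eq_sum_range (fun i : ℕ =>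
    if i + 1 < T ∧ (T : ℝ) - i ≤ y then 1 / ((T : ℝ) - i) else 0) T, ← sum_range_reflect]
  set w : ℕ → ℝ := fun i => if (T - 1 - i) + 1 < T ∧ (T : ℝ) - (T - 1 - i : ℕ) ≤ y
    then 1 / ((T : ℝ) - (T - 1 - i : ℕ)) else 0 with hw
  have hcast : ∀ i < T, (T : ℝ) - (T - 1 - i : ℕ) = i + 1 := by
    intro i hi
    rw [Nat.cast_sub (by omega), Nat.cast_sub (by omega)]
    push_cast; ring
  have hn : ⌊y⌋₊ ≤ T := by
    have := (Nat.floor_le hy.le).trans hyT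
    exact_mod_cast this
  have hlog : Real.log y ≤ ∑ i ∈ range ⌊y⌋₊, ((i : ℝ) + 1)⁻¹ := by
    have h1 := log_add_one_le_harmonic ⌊y⌋₊
    have h2 : ((harmonic ⌊y⌋₊ : ℚ) : ℝ) = ∑ i ∈ range ⌊y⌋₊, ((i : ℝ) + 1)⁻¹ := by
      simp [harmonic]
    rw [h2] at h1
    refine le_trans (Real.log_le_log hy ?_) h1
    exact_mod_cast (Nat.lt_floor_add_one y).le
  have hterm : ∀ i ∈ range ⌊y⌋₊, ((i : ℝ) + 1)⁻¹ ≤ (if i = 0 then 1 else 0) + w i := by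
    intro i hi
    rw [mem_range] at hi
    have hiy : (i : ℝ) + 1 ≤ y := by
      have h1 : ((i + 1 : ℕ) : ℝ) ≤ (⌊y⌋₊ : ℕ) := by exact_mod_cast hi
      push_cast at h1
      linarith [Nat.floor_le hy.le]
    by_cases h0 : i = 0
    · have hw0 : 0 ≤ w i := by
        simp only [hw, hcast i (by omega)]
        split_ifs <;> positivity
      subst h0
      simpa using hw0
    · simp only [hw, hcast i (by omega), h0, if_false, zero_add]
      rw [if_pos ⟨by omega, hiy⟩, one_div]
  have hsum := sum_le_sum hterm
  rw [sum_add_distrib, sum_ite_eq'] at hsum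
  have hone : (if 0 ∈ range ⌊y⌋₊ then (1 : ℝ) else 0) ≤ 1 := by split_ifs <;> norm_num
  have hext : ∑ i ∈ range ⌊y⌋₊, w i ≤ ∑ i ∈ range T, w i := by
    refine sum_le_sum_of_subset_of_nonneg (range_subset_range.2 hn) fun i hi _ => ?_
    rw [mem_range] at hi
    simp only [hw, hcast i hi]
    split_ifs <;> positivity
  linarith

open Finset in
/-- Given a balanced labelling, delete colour class `0` except its last label, saving the
vertices of colour `1` with the last label; then the unsaved vertices of colour `1`, the rest of
colour `0`, and finally the saved vertices. -/
theorem removable_of_balanced_labelling {V : Type*} [Fintype V] [DecidableEq V]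
    (G : SimpleGraph V) [DecidableRel G.Adj] (col : G.Coloring (Fin 2)) (d k T : ℕ) (α : ℝ)
    (hα0 : 0 < α) (hα1 : α ≤ 1) (hT : 2 ≤ T) (hTd : T ≤ d) (hTd2 : (T : ℝ) ^ 2 ≤ 32 * d)
    (hmax : ∀ v, G.degree v ≤ d) (hmin : ∀ v, α * d ≤ (G.degree v : ℝ)) (x : V → Fin T)
    (hx : ∀ v c, (G.degree v : ℝ) / (2 * T) ≤ #{w ∈ G.neighborFinset v | x w = c} ∧
      (#{w ∈ G.neighborFinset v | x w = c} : ℝ) ≤ 2 * G.degree v / T)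
    (hk : (k : ℝ) + 1 ≤ α * d / (2 * T))
    (hsum : 2 * ((k : ℝ) + 1) ≤ α * T / 64 * (Real.log (α * T / 8) - 1)) :
    Removable G univ (fun v => G.degree v - k) := by
  have hT0 : (0 : ℝ) < T := by exact_mod_cast (by omega : 0 < T)
  have hT2 : (2 : ℝ) ≤ T := by exact_mod_cast hT
  have hTd' : (T : ℝ) ≤ d := by exact_mod_cast hTd
  have hd0 : (0 : ℝ) < d := by linarith
  have hgap : ∀ v : V, (0 : ℝ) < T - (x v : ℕ) := fun v => by
    have : ((x v : ℕ) : ℝ) < T := by exact_mod_cast (x v).2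
    linarith
  have hgap1 : ∀ i : Fin T, (1 : ℝ) ≤ T - (i : ℕ) := fun i => by
    have : (((i : ℕ) + 1 : ℕ) : ℝ) ≤ T := by exact_mod_cast i.2
    push_cast at this
    linarith
  have hkdeg : ∀ v, (k : ℝ) + 1 ≤ G.degree v / (2 * T) := fun v =>
    hk.trans (by gcongr; exact hmin v)
  have hk4 : ∀ v, 4 * ((k : ℝ) + 1) ≤ G.degree v := fun v => by
    have := hkdeg v
    rw [le_div_iff₀ (by positivity)] at this
    nlinarith [(Nat.cast_nonneg k : (0 : ℝ) ≤ k)]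
  have hcol : ∀ {u v}, G.Adj u v → (col u = 0 ↔ col v = 1) := fun {u v} h => by
    have := col.valid h
    omega
  let A : Finset V := {a | col a = 0 ∧ (x a : ℕ) + 1 < T}
  let B : Finset V := {b | col b = 1 ∧ (x b : ℕ) + 1 = T}
  let last : Fin T := ⟨T - 1, by omega⟩
  let wt : Fin T → ℝ := fun i =>
    if (i : ℕ) + 1 < T ∧ (T : ℝ) - (i : ℕ) ≤ α * T / 8 then 1 / ((T : ℝ) - (i : ℕ)) else 0
  have hwt0 : ∀ i, 0 ≤ wt i := fun i => by
    simp only [wt]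
    have := hgap1 i
    split_ifs
    · exact div_nonneg zero_le_one (by linarith)
    · exact le_rfl
  have hwt1 : ∀ i, wt i ≤ 1 := fun i => by
    simp only [wt]
    have := hgap1 i
    split_ifs
    · rw [div_le_one (by linarith)]; exact this
    · exact zero_le_one
  let ω : V → ℝ := fun a => (T : ℝ) ^ 2 / (32 * d) * wt (x a)
  let m : V → ℕ := fun a => ⌊(G.degree a : ℝ) * T / (8 * d * (T - (x a : ℕ)))⌋₊
  obtain ⟨W, hWmem, hWcard, hWsaved⟩ := exists_saving_sets G A B ω
    (fun a => mul_nonneg (by positivity) (hwt0 _))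
    (fun a => mul_le_one₀ ((div_le_one (by positivity)).2 hTd2) (hwt0 _) (hwt1 _)) m (k + 1)
    (by
      intro b hb
      have hb' := (mem_filter.1 hb).2
      push_cast
      refine hsum.trans ?_
      have hcount : ∀ i : Fin T, α * T / 64 * wt i
          ≤ ∑ a ∈ {a ∈ A | G.Adj a b} with x a = i, ω a := by
        intro i
        have hconst : ∑ a ∈ {a ∈ A | G.Adj a b} with x a = i, ω a
            = #{a ∈ {a ∈ A | G.Adj a b} | x a = i} * ((T : ℝ) ^ 2 / (32 * d) * wt i) := by
          rw [← nsmul_eq_mul, ← sum_const]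
          refine sum_congr rfl fun a ha => ?_
          simp only [ω, (mem_filter.1 ha).2]
        rw [hconst]
        by_cases hi : (i : ℕ) + 1 < T
        · have hset : ({a ∈ {a ∈ A | G.Adj a b} | x a = i} : Finset V)
              = {w ∈ G.neighborFinset b | x w = i} := by
            ext a
            simp only [A, mem_filter, mem_univ, true_and, SimpleGraph.mem_neighborFinset]
            constructor
            · rintro ⟨⟨-, h⟩, h'⟩
              exact ⟨h.symm, h'⟩
            · rintro ⟨h, rfl⟩
              exact ⟨⟨⟨(hcol h.symm).2 hb'.1, hi⟩, h.symm⟩, rfl⟩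
          rw [hset]
          have h1 : α * d / (2 * T) ≤ (#{w ∈ G.neighborFinset b | x w = i} : ℝ) :=
            le_trans (by gcongr; exact hmin b) (hx b i).1
          have h2 := hwt0 i
          calc α * T / 64 * wt i = α * d / (2 * T) * ((T : ℝ) ^ 2 / (32 * d) * wt i) := by
                field_simp; ring
            _ ≤ _ := by gcongr
        · have : wt i = 0 := by simp only [wt]; rw [if_neg fun h => hi h.1]
          simp [this]
      rw [← sum_fiberwise {a ∈ A | G.Adj a b} x ω]
      refine le_trans ?_ (sum_le_sum fun i _ => hcount i)
      rw [← mul_sum]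
      refine mul_le_mul_of_nonneg_left ?_ (by positivity)
      exact log_sub_one_le_sum_reciprocal T (α * T / 8) (by positivity) (by nlinarith))
    (by
      intro a ha
      have hcard : (#{b ∈ B | G.Adj a b} : ℝ) ≤ 2 * G.degree a / T := by
        refine le_trans ?_ (hx a last).2
        gcongr
        intro b hb
        simp only [B, mem_filter, mem_univ, true_and, SimpleGraph.mem_neighborFinset] at hb ⊢
        refine ⟨hb.2, Fin.ext ?_⟩
        simp only [last]
        omega
      by_cases hgood : ((x a : Fin T) : ℕ) + 1 < T ∧ (T : ℝ) - (x a : ℕ) ≤ α * T / 8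
      · have hw : wt (x a) = 1 / ((T : ℝ) - (x a : ℕ)) := if_pos hgood
        set y : ℝ := (G.degree a : ℝ) * T / (8 * d * (T - (x a : ℕ))) with hy
        have hga := hgap a
        have hy1 : 1 ≤ y := by
          rw [hy, le_div_iff₀ (by positivity), one_mul]
          have h1 : 8 * d * ((T : ℝ) - (x a : ℕ)) ≤ 8 * d * (α * T / 8) := by
            gcongr; exact hgood.2
          have h2 : α * d * T ≤ G.degree a * T := by gcongr; exact hmin a
          linarith
        have hm : y / 2 ≤ (m a : ℝ) := by
          have h1 : (1 : ℝ) ≤ (⌊y⌋₊ : ℕ) := by exact_mod_cast (Nat.one_le_floor_iff y).2 hy1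
          have h2 := Nat.lt_floor_add_one y
          have h3 : (m a : ℝ) = (⌊y⌋₊ : ℕ) := rfl
          linarith
        refine le_trans ?_ hm
        calc ω a * (#{b ∈ B | G.Adj a b} : ℝ) ≤ ω a * (2 * G.degree a / T) := by
              have : 0 ≤ ω a := mul_nonneg (by positivity) (hwt0 _)
              gcongr
          _ = y / 2 := by
              simp only [ω, hw, hy]
              field_simp
              ring
      · have : ω a = 0 := by simp only [ω, wt]; rw [if_neg hgood, mul_zero]
        rw [this, zero_mul]
        exact Nat.cast_nonneg _)
  let phase : V → ℕ := fun v =>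
    if col v = 0 then (if (x v : ℕ) + 1 < T then (x v : ℕ) else T)
    else (if (x v : ℕ) + 1 < T then T - 1 else T + 1)
  let e := Fintype.equivFin V
  let r : V → ℕ := fun v => phase v * Fintype.card V + e v
  have hr_lt : ∀ {u v}, phase u < phase v → r u < r v := fun {u v} h => by
    have h1 := (e u).2
    have h2 : (phase u + 1) * Fintype.card V ≤ phase v * Fintype.card V :=
      Nat.mul_le_mul_right _ h
    have h3 : (phase u + 1) * Fintype.card V = phase u * Fintype.card V + Fintype.card V := by
      ring
    simp only [r]
    omega
  have hr_inj : Function.Injective r := by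
    intro u v h
    have hp : phase u = phase v := by
      rcases lt_trichotomy (phase u) (phase v) with h' | h' | h'
      · exact absurd h (hr_lt h').ne
      · exact h'
      · exact absurd h (hr_lt h').ne'
    simp only [r, hp] at h
    exact e.injective (Fin.ext (by omega))
  have hxlt : ∀ v, (x v : ℕ) < T := fun v => (x v).2
  have hphaseA : ∀ {a}, a ∈ A → phase a = x a := fun {a} ha => by
    have h := (mem_filter.1 ha).2
    simp only [phase, h.1, h.2, if_true]
  have hphase1 : ∀ {v}, col v = 1 → T - 1 ≤ phase v := fun {v} hv => by
    simp only [phase, hv]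
    split_ifs <;> omega
  have hWlater : ∀ u, ∀ w ∈ W u, r u < r w ∧ G.Adj u w := by
    intro u w hw
    obtain ⟨hu, hwB, hadj⟩ := hWmem u w hw
    refine ⟨hr_lt ?_, hadj⟩
    have h1 := hphaseA hu
    have h2 := hphase1 (mem_filter.1 hwB).2.1
    have h3 := (mem_filter.1 hu).2.2
    omega
  have hpos : ∀ v, #{u | r u < r v ∧ G.Adj u v ∧ v ∉ W u} < G.degree v - k := by
    intro v
    obtain ⟨Q, hQsub, hQcard, hQ⟩ : ∃ Q ⊆ G.neighborFinset v, k + 1 ≤ #Q ∧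
        ∀ u ∈ Q, r v < r u ∨ v ∈ W u := by
      by_cases hv : v ∈ B
      · refine ⟨({a | v ∈ W a} : Finset V), fun a ha => ?_, (hWsaved v hv).ge, fun u hu => ?_⟩
        · rw [SimpleGraph.mem_neighborFinset]
          exact (hWmem a v (mem_filter.1 ha).2).2.2.symm
        · exact Or.inr (mem_filter.1 hu).2
      · refine ⟨{w ∈ G.neighborFinset v | x w = last}, filter_subset _ _, ?_, fun u hu => ?_⟩
        · have := (hkdeg v).trans (hx v last).1
          exact_mod_cast this
        · refine Or.inl (hr_lt ?_)
          obtain ⟨hadj, hlast⟩ := mem_filter.1 hu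
          rw [SimpleGraph.mem_neighborFinset] at hadj
          have hxu : (x u : ℕ) + 1 = T := by
            rw [hlast]; simp only [last]; omega
          have hc := hcol hadj
          have hv' : ¬ (col v = 1 ∧ (x v : ℕ) + 1 = T) := fun h => hv (mem_filter.2 ⟨mem_univ _, h⟩)
          have hxv := hxlt v
          simp only [phase]
          by_cases h0 : col v = 0
          · have hu1 : ¬ col u = 0 := by have := hc.1 h0; omega
            simp only [h0, hu1, if_true, if_false]
            split_ifs <;> omega
          · have hu0 : col u = 0 := by
              have : ¬ col u = 1 := fun h => h0 (hc.2 h)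
              omega
            have hv1 : col v = 1 := by omega
            have : (x v : ℕ) + 1 < T := by
              have : ¬ (x v : ℕ) + 1 = T := fun h => hv' ⟨hv1, h⟩
              omega
            simp only [h0, hu0, this, if_true, if_false]
            split_ifs <;> omega
    have hdisj : Disjoint ({u | r u < r v ∧ G.Adj u v ∧ v ∉ W u} : Finset V) Q := by
      refine disjoint_left.2 fun u hu huQ => ?_
      simp only [mem_filter, mem_univ, true_and] at hu
      rcases hQ u huQ with h | h
      · omega
      · exact hu.2.2 h
    have hle : #(({u | r u < r v ∧ G.Adj u v ∧ v ∉ W u} : Finset V) ∪ Q) ≤ G.degree v := by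
      rw [← G.card_neighborFinset_eq_degree]
      refine card_le_card (union_subset (fun u hu => ?_) hQsub)
      rw [SimpleGraph.mem_neighborFinset]
      exact (mem_filter.1 hu).2.2.1.symm
    rw [card_union_of_disjoint hdisj] at hle
    omega
  refine removable_of_schedule G _ r hr_inj W hWlater hpos fun u => ?_
  rcases (W u).eq_empty_or_nonempty with hemp | ⟨w₀, hw₀⟩
  · have := hpos u
    rw [hemp, sum_empty]
    omega
  have hu := (hWmem u w₀ hw₀).1
  have huA := (mem_filter.1 hu).2
  have hnone : ({y | r y < r u ∧ G.Adj y u ∧ u ∉ W y} : Finset V) = ∅ := by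
    refine filter_eq_empty_iff.2 fun y _ hy => ?_
    have h1 := hphaseA hu
    have h2 := hphase1 ((hcol hy.2.1.symm).1 huA.1)
    have h3 := hr_lt (u := u) (v := y) (by omega)
    omega
  rw [hnone, card_empty, Nat.sub_zero]
  have hgu := hgap u
  have hcost : ∀ w ∈ W u, ((G.degree w - k - #{y | r y < r u ∧ G.Adj y w ∧ w ∉ W y} : ℕ) : ℝ)
      ≤ 3 * d * (T - (x u : ℕ)) / T := by
    intro w hw
    have hwB := (hWmem u w hw).2.1
    have hw1 := (mem_filter.1 hwB).2.1
    have hcover : G.neighborFinset w ⊆ ({y | r y < r u ∧ G.Adj y w ∧ w ∉ W y} : Finset V)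
        ∪ (({y | w ∈ W y} : Finset V)
          ∪ (Ici (x u)).biUnion fun c => {y ∈ G.neighborFinset w | x y = c}) := by
      intro y hy
      have hadj := (G.mem_neighborFinset w y).1 hy
      simp only [mem_union, mem_filter, mem_univ, true_and, mem_biUnion, mem_Ici]
      by_cases h1 : r y < r u
      · by_cases h2 : w ∈ W y
        · exact Or.inr (Or.inl h2)
        · exact Or.inl ⟨h1, hadj.symm, h2⟩
      · refine Or.inr (Or.inr ⟨x y, ?_, hy, rfl⟩)
        have h2 : phase u ≤ phase y := by
          by_contra hc
          exact h1 (hr_lt (not_le.1 hc))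
        have hy0 : col y = 0 := (hcol hadj.symm).2 hw1
        rw [hphaseA hu] at h2
        have h3 := hxlt y
        have h4 := hxlt u
        rw [Fin.le_def]
        simp only [phase, hy0, if_true] at h2
        split_ifs at h2 <;> omega
    have hcard := (card_le_card hcover).trans ((card_union_le _ _).trans
      (Nat.add_le_add_left (card_union_le _ _) _))
    rw [hWsaved w hwB, G.card_neighborFinset_eq_degree] at hcard
    set Y := (Ici (x u)).biUnion fun c => {y ∈ G.neighborFinset w | x y = c} with hY
    have hYle : (#Y : ℝ) ≤ (T - (x u : ℕ)) * (2 * d / T) := by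
      calc (#Y : ℝ) ≤ ∑ c ∈ Ici (x u), (#{y ∈ G.neighborFinset w | x y = c} : ℝ) := by
            exact_mod_cast card_biUnion_le
        _ ≤ #(Ici (x u)) • (2 * d / T : ℝ) := by
            refine sum_le_card_nsmul _ _ _ fun c _ => (hx w c).2.trans ?_
            gcongr
            exact hmax w
        _ = (T - (x u : ℕ)) * (2 * d / T) := by
            rw [Fin.card_Ici, nsmul_eq_mul, Nat.cast_sub (hxlt u).le]
    have hle : (G.degree w - k - #{y | r y < r u ∧ G.Adj y w ∧ w ∉ W y}) ≤ #Y + 1 := by omega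
    have hone : 1 ≤ (d : ℝ) / T := (one_le_div hT0).2 hTd'
    have hg1 := hgap1 (x u)
    calc ((G.degree w - k - #{y | r y < r u ∧ G.Adj y w ∧ w ∉ W y} : ℕ) : ℝ)
        ≤ #Y + 1 := by exact_mod_cast hle
      _ ≤ (T - (x u : ℕ)) * (2 * d / T) + (T - (x u : ℕ)) * (d / T) := by nlinarith
      _ = 3 * d * (T - (x u : ℕ)) / T := by ring
  have hreal : ((∑ w ∈ W u, (G.degree w - k - #{y | r y < r u ∧ G.Adj y w ∧ w ∉ W y}) : ℕ) : ℝ)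
      ≤ 3 / 8 * G.degree u := by
    have hmle : (m u : ℝ) ≤ (G.degree u : ℝ) * T / (8 * d * (T - (x u : ℕ))) :=
      Nat.floor_le (by positivity)
    have hWm : (#(W u) : ℝ) ≤ m u := by exact_mod_cast hWcard u
    push_cast only [Nat.cast_sum]
    calc _ ≤ #(W u) • (3 * d * (T - (x u : ℕ)) / T : ℝ) := sum_le_card_nsmul _ _ _ hcost
      _ ≤ (G.degree u : ℝ) * T / (8 * d * (T - (x u : ℕ))) * (3 * d * (T - (x u : ℕ)) / T) := by
          rw [nsmul_eq_mul]
          gcongr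
          exact hWm.trans hmle
      _ = 3 / 8 * G.degree u := by field_simp
  have hku := hk4 u
  have hkle : k ≤ G.degree u := by
    have : (k : ℝ) ≤ G.degree u := by linarith [(Nat.cast_nonneg k : (0 : ℝ) ≤ k)]
    exact_mod_cast this
  have : ((∑ w ∈ W u, (G.degree w - k - #{y | r y < r u ∧ G.Adj y w ∧ w ∉ W y}) : ℕ) : ℝ)
      < (G.degree u - k : ℕ) := by
    rw [Nat.cast_sub hkle]
    linarith
  exact_mod_cast this

theorem exists_forall_label_count (α : ℝ) (hα0 : 0 < α) (hα1 : α ≤ 1) :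
    ∃ d₀ : ℕ, ∀ d : ℕ, d₀ ≤ d → ∃ T : ℕ, 2 ≤ T ∧ T ≤ d ∧ (T : ℝ) ^ 2 ≤ 32 * d ∧
      8 * (d : ℝ) ^ 2 * T * Real.exp (-(α * d / (10 * T))) ≤ 1 ∧
      (⌊(α / 1000) * Real.sqrt (d * Real.log d)⌋₊ : ℝ) + 1 ≤ α * d / (2 * T) ∧
      2 * ((⌊(α / 1000) * Real.sqrt (d * Real.log d)⌋₊ : ℝ) + 1)
        ≤ α * T / 64 * (Real.log (α * T / 8) - 1) := by
  have hlogα : Real.log α ≤ 0 := Real.log_nonpos hα0.le hα1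
  refine ⟨⌈Real.exp (2000 - 16 * Real.log α)⌉₊, fun d hd => ?_⟩
  have hd1 : Real.exp (2000 - 16 * Real.log α) ≤ d := Nat.ceil_le.1 hd
  have hd0 : (0 : ℝ) < d := (Real.exp_pos _).trans_le hd1
  set L := Real.log d with hL
  have hLM : 2000 - 16 * Real.log α ≤ L := (Real.le_log_iff_exp_le hd0).2 hd1
  have hL2 : 2000 ≤ L := by linarith
  have hL0 : 0 < L := by linarith
  set q := Real.sqrt (d / L) with hq
  have hq0 : 0 < q := Real.sqrt_pos.2 (by positivity)
  have hdq : (d : ℝ) = L * q ^ 2 := by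
    rw [hq, Real.sq_sqrt (by positivity)]; field_simp
  have hs : Real.sqrt (d * L) = L * q := by
    rw [show (d : ℝ) * L = (L * q) ^ 2 by rw [hdq]; ring]
    exact Real.sqrt_sq (by positivity)
  have hlogq : Real.log q = (L - Real.log L) / 2 := by
    rw [hq, Real.log_sqrt (by positivity), Real.log_div hd0.ne' hL0.ne']
  have hloglog : Real.log L ≤ L / 8 + 6 := by
    have h1 : Real.log L = Real.log (L / 8) + Real.log 8 := by
      rw [← Real.log_mul (by positivity) (by norm_num)]; congr 1; ring
    have h2 := Real.log_le_sub_one_of_pos (show 0 < L / 8 by positivity)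
    have h3 := Real.log_le_sub_one_of_pos (show (0 : ℝ) < 8 by norm_num)
    linarith
  have hlogαq : 1 + L / 4 ≤ Real.log (α * q) := by
    rw [Real.log_mul hα0.ne' hq0.ne', hlogq]
    linarith
  have hαq : 500 ≤ α * q := by
    have h1 := (Real.le_log_iff_exp_le (by positivity)).1 hlogαq
    have h2 := Real.add_one_le_exp (1 + L / 4)
    linarith
  have hq1 : 500 ≤ q := by nlinarith
  set s := α * (L * q) with hsdef
  have hs0 : 1000000 ≤ s := by
    have : s = L * (α * q) := by rw [hsdef]; ring
    rw [this]; nlinarith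
  have hk : (⌊(α / 1000) * Real.sqrt (d * L)⌋₊ : ℝ) ≤ s / 1000 := by
    refine (Nat.floor_le (by positivity)).trans (le_of_eq ?_)
    rw [hs, hsdef]; ring
  have hT1 : (⌊10 * q⌋₊ : ℝ) ≤ 10 * q := Nat.floor_le (by positivity)
  have hT2 : 9 * q ≤ (⌊10 * q⌋₊ : ℝ) := by
    have := (Nat.lt_floor_add_one (10 * q)).le
    linarith
  set T := ⌊10 * q⌋₊ with hT
  have hT0 : (0 : ℝ) < T := by linarith
  have hTd : (T : ℝ) ≤ d := by
    rw [hdq]; nlinarith [mul_pos hL0 hq0]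
  have hdT : s / 20 ≤ α * d / (2 * T) := by
    rw [le_div_iff₀ (by positivity)]
    calc s / 20 * (2 * T) ≤ s / 20 * (2 * (10 * q)) := by gcongr
      _ = α * d := by rw [hdq, hsdef]; ring
  refine ⟨T, ?_, by exact_mod_cast hTd, ?_, ?_, by linarith, ?_⟩
  · have : (2 : ℝ) ≤ T := by linarith
    exact_mod_cast this
  · rw [hdq]
    have : (T : ℝ) ^ 2 ≤ (10 * q) ^ 2 := by gcongr
    nlinarith [sq_nonneg q]
  · have h1 : s / 100 ≤ α * d / (10 * T) := by
      have : α * d / (10 * T) = α * d / (2 * T) / 5 := by field_simp; norm_num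
      rw [this]; linarith
    have h2 : 3 * L + 8 ≤ s / 100 := by
      have : s = L * (α * q) := by rw [hsdef]; ring
      rw [this]; nlinarith
    have hdexp : Real.exp L = d := Real.exp_log hd0
    have h8 : (8 : ℝ) ≤ Real.exp 8 := by linarith [Real.add_one_le_exp (8 : ℝ)]
    have h3 : 8 * (d : ℝ) ^ 2 * T ≤ Real.exp (3 * L + 8) := by
      rw [Real.exp_add, show (3 : ℝ) * L = (3 : ℕ) * L by norm_num, Real.exp_nat_mul, hdexp]
      calc 8 * (d : ℝ) ^ 2 * T ≤ Real.exp 8 * (d : ℝ) ^ 2 * d := by gcongr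
        _ = _ := by ring
    calc 8 * (d : ℝ) ^ 2 * T * Real.exp (-(α * d / (10 * T)))
        ≤ Real.exp (3 * L + 8) * Real.exp (-(3 * L + 8)) := by
          gcongr; linarith
      _ = 1 := by rw [← Real.exp_add]; simp
  · have h1 : Real.log (α * q) ≤ Real.log (α * T / 8) := by
      apply Real.log_le_log (by positivity)
      have : α * (9 * q) ≤ α * T := by gcongr
      nlinarith
    have h2 : α * (9 * q) / 64 * (L / 4) ≤ α * T / 64 * (Real.log (α * T / 8) - 1) := by
      gcongr; linarith
    have h3 : α * (9 * q) / 64 * (L / 4) = 9 / 256 * s := by rw [hsdef]; ring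
    linarith

/-- For each `0 < α ≤ 1` there is `d₀` such that for all `d ≥ d₀`:
every bipartite graph of maximum degree at most `d` and minimum degree at least `α·d`
is `f`-removable for `f(v) = deg(v) - ⌊(α/1000)·√(d log d)⌋`. -/
theorem statement15 (α : ℝ) (hα0 : 0 < α) (hα1 : α ≤ 1) :
    ∃ d₀ : ℕ, ∀ d : ℕ, d₀ ≤ d →
      ∀ (V : Type) [Fintype V] [DecidableEq V] (G : SimpleGraph V) [DecidableRel G.Adj],
        G.Colorable 2 →
        (∀ v, G.degree v ≤ d) →
        (∀ v, α * d ≤ (G.degree v : ℝ)) →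
        Removable G Finset.univ
          (fun v => G.degree v - ⌊(α / 1000) * Real.sqrt (d * Real.log d)⌋₊) := by
  obtain ⟨d₀, h⟩ := exists_forall_label_count α hα0 hα1
  refine ⟨d₀, fun d hd V _ _ G _ hcol hmax hmin => ?_⟩
  obtain ⟨T, hT, hTd, hTd2, hprob, hk, hsum⟩ := h d hd
  obtain ⟨x, hx⟩ := exists_balanced_labelling G d T α (by omega) (by omega) hmax hmin hprob
  exact removable_of_balanced_labelling G hcol.some d _ T α hα0 hα1 hT hTd hTd2 hmax hmin x hx
    hk hsum
end
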